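/- Let P be a Gibbs random field with determining filtration F = (Λ_n) and corresponding sets of admissible boundary conditions Y_t(F), t ∈ ℤ^d. Then for any filtration F' = (Λ'_n) and any t ∈ ℤ^d, x ∈ X, the sequence of finite-conditional probabilities g_t^{x̄_{Λ'_n∖{t}}}(x) converges as n → ∞ to the same limit g_t^{x̄}(x) (the limit along F), uniformly with respect to x̄ ∈ Y_t(F). -/

import Mathlib

open MeasureTheory Filter Topology

noncomputable section

/-- Sites of the lattice `ℤ^d`. -/
abbrev Site (d : ℕ) := Fin d → ℤ

/-- Configurations on the whole lattice. -/
abbrev Config (d : ℕ) (X : Type*) := Site d → X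

variable {d : ℕ} {X : Type*}

/-- The configuration equal to `x` on `V` and to `z` off `V` (the concatenation `xz`). -/
def concat (V : Finset (Site d)) (x z : Config d X) : Config d X :=
  fun t => if t ∈ V then x t else z t

/-- The configuration equal to `u` on `I` and to `y` off `I`. -/
def extCfg (I : Finset (Site d)) (u : {s // s ∈ I} → X) (y : Config d X) : Config d X :=
  fun t => if h : t ∈ I then u ⟨t, h⟩ else y t

/-- The cylinder set determined by the values of `z` on `Λ`. -/
def cyl (Λ : Finset (Site d)) (z : Config d X) : Set (Config d X) :=
  {ω | ∀ t ∈ Λ, ω t = z t}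

/-- Finite-dimensional distribution `P_Λ(z)`. -/
def fdd [MeasurableSpace X] (P : Measure (Config d X)) (Λ : Finset (Site d))
    (z : Config d X) : ℝ :=
  (P (cyl Λ z)).toReal

/-- A positive random field: all finite-dimensional distributions are positive. -/
def IsPositiveRF [MeasurableSpace X] (P : Measure (Config d X)) : Prop :=
  ∀ Λ : Finset (Site d), Λ.Nonempty → ∀ z : Config d X, 0 < fdd P Λ z

/-- Finite-conditional probability `g_V^z(x)` with boundary condition `z` on `Λ`. -/
def gfin [MeasurableSpace X] (P : Measure (Config d X)) (V Λ : Finset (Site d))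
    (x z : Config d X) : ℝ :=
  fdd P (V ∪ Λ) (concat V x z) / fdd P Λ z

/-- A filtration: an increasing sequence of finite subsets of the lattice with union `ℤ^d`. -/
structure Filt (d : ℕ) where
  Λ : ℕ → Finset (Site d)
  mono : Monotone Λ
  covers : ∀ t : Site d, ∃ n, t ∈ Λ n

/-- The set `𝒳_V(F)` of admissible boundary conditions: those `x̄` for which all the limits
`lim_n g_V^{x̄_{Λ_n ∖ V}}(x)` exist. (Only the values of `x̄` off `V` are ever used.) -/
def admissible [MeasurableSpace X] (P : Measure (Config d X)) (V : Finset (Site d))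
    (F : Filt d) : Set (Config d X) :=
  {xb | ∀ x : Config d X, ∃ L : ℝ,
    Tendsto (fun n => gfin P V (F.Λ n \ V) x xb) atTop (𝓝 L)}

/-- The conditional probability `g_V^{x̄}(x)` : the limit of `g_V^{x̄_{Λ_n ∖ V}}(x)`. -/
def gCond [MeasurableSpace X] (P : Measure (Config d X)) (V : Finset (Site d))
    (F : Filt d) (xb x : Config d X) : ℝ :=
  limUnder atTop (fun n => gfin P V (F.Λ n \ V) x xb)

/-- Transition energy `Δ_V^{x̄}(x,u) = ln (g_V^{x̄}(x) / g_V^{x̄}(u))`. -/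
def TE [MeasurableSpace X] (P : Measure (Config d X)) (V : Finset (Site d))
    (F : Filt d) (xb x u : Config d X) : ℝ :=
  Real.log (gCond P V F xb x / gCond P V F xb u)

/-- Quasilocality (on boundary conditions off `V`) of a function `h` on a set `Y` of
boundary conditions. -/
def QuasilocalOn (V : Finset (Site d)) (Y : Set (Config d X)) (h : Config d X → ℝ) : Prop :=
  ∀ ε > 0, ∃ Λε : Finset (Site d), Disjoint Λε V ∧
    ∀ Λ : Finset (Site d), Disjoint Λ V → Λε ⊆ Λ →
      ∀ xb ∈ Y, ∀ yb ∈ Y, (∀ s ∈ Λ, xb s = yb s) → |h xb - h yb| < ε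

/-- `Y` represents a set of boundary conditions on `ℤ^d ∖ {t}`: membership does not depend
on the value at `t`. -/
def IsBCSet (t : Site d) (Y : Set (Config d X)) : Prop :=
  ∀ (ω : Config d X) (a : X), ω ∈ Y → Function.update ω t a ∈ Y

/-- `F` is a determining filtration for `P` with sets `Y t` of admissible boundary conditions:
the one-point finite-conditional probabilities converge, uniformly over `Y t`, to positive
limits, and `P(Y t) = 1`. -/
structure IsDetermining [MeasurableSpace X] (P : Measure (Config d X)) (F : Filt d)
    (Y : Site d → Set (Config d X)) : Prop where
  meas : ∀ t, MeasurableSet (Y t)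
  bc : ∀ t, IsBCSet t (Y t)
  adm : ∀ t, Y t ⊆ admissible P {t} F
  full : ∀ t, P (Y t) = 1
  pos : ∀ t, ∀ xb ∈ Y t, ∀ x : X, 0 < gCond P {t} F xb (fun _ => x)
  unif : ∀ (t : Site d) (x : X), ∀ ε > 0, ∃ N, ∀ n ≥ N, ∀ xb ∈ Y t,
    |gfin P {t} (F.Λ n \ {t}) (fun _ => x) xb - gCond P {t} F xb (fun _ => x)| < ε

/-- The probabilistic (Pr--) definition of a Gibbs random field. -/
def IsGibbsRF [MeasurableSpace X] (P : Measure (Config d X)) : Prop :=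
  IsProbabilityMeasure P ∧ IsPositiveRF P ∧
    ∃ (F : Filt d) (Y : Site d → Set (Config d X)), IsDetermining P F Y

section

lemma cyl_congr {Λ : Finset (Site d)} {z w : Config d X} (h : ∀ s ∈ Λ, z s = w s) :
    cyl Λ z = cyl Λ w := by
  ext ω
  exact forall₂_congr fun s hs => by rw [h s hs]

variable [MeasurableSpace X]

lemma fdd_congr (P : Measure (Config d X)) {Λ : Finset (Site d)} {z w : Config d X}
    (h : ∀ s ∈ Λ, z s = w s) : fdd P Λ z = fdd P Λ w := by
  rw [fdd, cyl_congr h, fdd]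

lemma gfin_congr (P : Measure (Config d X)) {V Λ : Finset (Site d)} (x : Config d X)
    {z w : Config d X} (h : ∀ s ∈ Λ, z s = w s) : gfin P V Λ x z = gfin P V Λ x w := by
  rw [gfin, gfin, fdd_congr P h, fdd_congr P (z := concat V x z) (w := concat V x w)]
  intro s hs
  by_cases hV : s ∈ V
  · simp [concat, hV]
  · simp [concat, hV, h s ((Finset.mem_union.1 hs).resolve_left hV)]

lemma measurableSet_cyl [MeasurableSingletonClass X] (Λ : Finset (Site d)) (z : Config d X) :
    MeasurableSet (cyl Λ z) := by
  have : cyl Λ z = ⋂ t ∈ Λ, (fun ω : Config d X => ω t) ⁻¹' {z t} := by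
    ext ω
    simp [cyl]
  rw [this]
  exact Λ.measurableSet_biInter fun t _ => measurable_pi_apply t (measurableSet_singleton _)

lemma IsPositiveRF.fdd_pos {P : Measure (Config d X)} [IsProbabilityMeasure P]
    (hP : IsPositiveRF P) (Λ : Finset (Site d)) (z : Config d X) : 0 < fdd P Λ z := by
  rcases Λ.eq_empty_or_nonempty with rfl | h
  · simp [fdd, cyl]
  · exact hP Λ h z

lemma fdd_eq_sum_insert [Fintype X] [MeasurableSingletonClass X] (P : Measure (Config d X))
    [IsProbabilityMeasure P] {Λ : Finset (Site d)} {s : Site d} (hs : s ∉ Λ)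
    (z : Config d X) :
    fdd P Λ z = ∑ a, fdd P (insert s Λ) (Function.update z s a) := by
  have key : ∀ (a : X) (ω : Config d X),
      ω ∈ cyl (insert s Λ) (Function.update z s a) ↔ ω s = a ∧ ω ∈ cyl Λ z := by
    intro a ω
    simp only [cyl, Set.mem_ofPred_eq, Finset.forall_mem_insert, Function.update_self]
    refine and_congr_right fun _ => forall₂_congr fun r hr => ?_
    rw [Function.update_of_ne (ne_of_mem_of_not_mem hr hs)]
  have hU : cyl Λ z = ⋃ a, cyl (insert s Λ) (Function.update z s a) := by
    ext ω
    simp [key]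
  have hd : Pairwise
      (Function.onFun Disjoint fun a => cyl (insert s Λ) (Function.update z s a)) := by
    intro a b hab
    refine Set.disjoint_left.2 fun ω ha hb => hab ?_
    rw [← ((key a ω).1 ha).1, ← ((key b ω).1 hb).1]
  rw [fdd, hU, measure_iUnion hd fun _ => measurableSet_cyl _ _, tsum_fintype,
    ENNReal.toReal_sum fun _ _ => measure_ne_top _ _]
  rfl

/-- A bound on finite-conditional probabilities over a larger volume `Λ ∪ D` passes to the
smaller volume `Λ` (in multiplied-out form). -/
lemma abs_fdd_sub_le_of_union [Fintype X] [MeasurableSingletonClass X]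
    (P : Measure (Config d X)) [IsProbabilityMeasure P] (V : Finset (Site d))
    (x : Config d X) (c ε : ℝ) (D : Finset (Site d)) :
    ∀ (Λ : Finset (Site d)), Disjoint D V → Disjoint D Λ → ∀ z : Config d X,
      (∀ ω ∈ cyl Λ z, |fdd P (V ∪ (Λ ∪ D)) (concat V x ω) - c * fdd P (Λ ∪ D) ω| ≤
        ε * fdd P (Λ ∪ D) ω) →
      |fdd P (V ∪ Λ) (concat V x z) - c * fdd P Λ z| ≤ ε * fdd P Λ z := by
  induction D using Finset.induction_on with
  | empty =>
    intro Λ _ _ z h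
    simpa using h z fun _ _ => rfl
  | insert s D hs ih =>
    intro Λ hV hΛ z h
    rw [Finset.disjoint_insert_left] at hV hΛ
    have hstep : ∀ a, |fdd P (V ∪ insert s Λ) (concat V x (Function.update z s a)) -
        c * fdd P (insert s Λ) (Function.update z s a)| ≤
        ε * fdd P (insert s Λ) (Function.update z s a) := by
      intro a
      refine ih (insert s Λ) hV.2 (Finset.disjoint_insert_right.2 ⟨hs, hΛ.2⟩) _ fun ω hω => ?_
      rw [Finset.insert_union, ← Finset.union_insert]
      refine h ω fun r hr => ?_
      rw [hω r (Finset.mem_insert_of_mem hr),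
        Function.update_of_ne (ne_of_mem_of_not_mem hr hΛ.1)]
    have hconcat : ∀ a, Function.update (concat V x z) s a =
        concat V x (Function.update z s a) := by
      intro a
      ext r
      by_cases hr : r = s
      · subst hr
        simp [concat, hV.1]
      · simp [concat, hr]
    rw [fdd_eq_sum_insert P hΛ.1 z,
      fdd_eq_sum_insert P (s := s) (by simp [hV.1, hΛ.1]) (concat V x z),
      Finset.mul_sum, Finset.mul_sum, ← Finset.sum_sub_distrib]
    refine (Finset.abs_sum_le_sum_abs _ _).trans (Finset.sum_le_sum fun a _ => ?_)
    rw [hconcat, ← Finset.union_insert]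
    exact hstep a

lemma abs_gfin_sub_le_iff {P : Measure (Config d X)} [IsProbabilityMeasure P]
    (hP : IsPositiveRF P) (V Λ : Finset (Site d)) (x z : Config d X) (c ε : ℝ) :
    |gfin P V Λ x z - c| ≤ ε ↔
      |fdd P (V ∪ Λ) (concat V x z) - c * fdd P Λ z| ≤ ε * fdd P Λ z := by
  have h := hP.fdd_pos Λ z
  rw [gfin, div_sub' h.ne', abs_div, abs_of_pos h, div_le_iff₀ h, mul_comm c]

lemma abs_gfin_sub_le_of_subset [Fintype X] [MeasurableSingletonClass X]
    {P : Measure (Config d X)} [IsProbabilityMeasure P] (hP : IsPositiveRF P)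
    {V Λ M : Finset (Site d)} (hΛM : Λ ⊆ M) (hM : Disjoint M V) (x z : Config d X)
    {c ε : ℝ} (h : ∀ ω ∈ cyl Λ z, |gfin P V M x ω - c| ≤ ε) :
    |gfin P V Λ x z - c| ≤ ε := by
  rw [abs_gfin_sub_le_iff hP]
  refine abs_fdd_sub_le_of_union P V x c ε (M \ Λ) Λ
    (hM.mono_left Finset.sdiff_subset) Finset.sdiff_disjoint z fun ω hω => ?_
  rw [Finset.union_sdiff_of_subset hΛM]
  exact (abs_gfin_sub_le_iff hP _ _ _ _ _ _).1 (h ω hω)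

lemma IsPositiveRF.exists_mem_cyl [MeasurableSingletonClass X] {P : Measure (Config d X)}
    [IsProbabilityMeasure P] (hP : IsPositiveRF P) {Y : Set (Config d X)}
    (hY : MeasurableSet Y) (hfull : P Y = 1) (Λ : Finset (Site d)) (z : Config d X) :
    ∃ ω ∈ Y, ω ∈ cyl Λ z := by
  by_contra! h
  have h0 : P (cyl Λ z) = 0 :=
    measure_mono_null (fun ω hω hωY => h ω hωY hω) ((prob_compl_eq_zero_iff hY).2 hfull)
  simpa [fdd, h0] using hP.fdd_pos Λ z

lemma Filt.exists_superset (F : Filt d) (S : Finset (Site d)) : ∃ n, S ⊆ F.Λ n := by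
  choose m hm using F.covers
  exact ⟨S.sup m, fun s hs => F.mono (Finset.le_sup hs) (hm s)⟩

end

/-- Theorem 3 / `GibbsProperty`. -/
theorem stmt7 [Fintype X] [Nontrivial X] [MeasurableSpace X] [MeasurableSingletonClass X]
    (P : Measure (Config d X)) [IsProbabilityMeasure P] (hP : IsPositiveRF P)
    (F : Filt d) (Y : Site d → Set (Config d X)) (hdet : IsDetermining P F Y) :
    ∀ (F' : Filt d) (t : Site d) (x : X), ∀ ε > 0, ∃ N, ∀ n ≥ N, ∀ xb ∈ Y t,
      |gfin P {t} (F'.Λ n \ {t}) (fun _ => x) xb -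
          gCond P {t} F xb (fun _ => x)| < ε := by
  intro F' t x ε hε
  obtain ⟨N, hN⟩ := hdet.unif t x (ε / 4) (by positivity)
  obtain ⟨N', hN'⟩ := F'.exists_superset (F.Λ N)
  refine ⟨N', fun n hn xb hxb => ?_⟩
  have hsub : F.Λ N \ {t} ⊆ F'.Λ n \ {t} :=
    Finset.sdiff_subset_sdiff (hN'.trans (F'.mono hn)) subset_rfl
  obtain ⟨k, hk⟩ := F.exists_superset (F'.Λ n)
  set m := max k N
  have hsub' : F'.Λ n \ {t} ⊆ F.Λ m \ {t} :=
    Finset.sdiff_subset_sdiff (hk.trans (F.mono (le_max_left k N))) subset_rfl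
  have hclose : |gfin P {t} (F'.Λ n \ {t}) (fun _ => x) xb -
      gfin P {t} (F.Λ N \ {t}) (fun _ => x) xb| ≤ ε / 2 := by
    refine abs_gfin_sub_le_of_subset hP hsub' Finset.sdiff_disjoint _ _ fun ω hω => ?_
    obtain ⟨η, hηY, hη⟩ := hP.exists_mem_cyl (hdet.meas t) (hdet.full t) (F.Λ m \ {t}) ω
    rw [gfin_congr P _ fun s hs => (hη s hs).symm,
      gfin_congr P (w := η) (Λ := F.Λ N \ {t}) (z := xb) _ fun s hs => by
        rw [hη s (hsub' (hsub hs)), hω s (hsub hs)]]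
    have h₁ := abs_lt.1 (hN m (le_max_right k N) η hηY)
    have h₂ := abs_lt.1 (hN N le_rfl η hηY)
    rw [abs_le]
    constructor <;> linarith
  have h₁ := abs_le.1 hclose
  have h₂ := abs_lt.1 (hN N le_rfl xb hxb)
  rw [abs_lt]
  constructor <;> linarith
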